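/- arXiv:math/0508092 — 4 statements merged into one kernel-verified Lean document; each statement's English description precedes it below -/
import Mathlib

section
/- Let I ⊆ ℕ^n be a monoid ideal. Then the integral closure of I equals the set of lattice points of its Newton polyhedron: Ī = New(I) ∩ ℕ^n. -/
open scoped Pointwise

/-- The `r`-fold Minkowski sum `I + ⋯ + I` (`r` summands; the empty sum is `{0}`). -/
def rFold {α : Type*} [AddCommMonoid α] : ℕ → Set α → Set α
  | 0, _ => {0}
  | k + 1, I => I + rFold k I

/-- The inclusion `ℕ^n ⊆ ℝ^n`. -/
def natToReal (n : ℕ) (a : Fin n → ℕ) : Fin n → ℝ := fun i => (a i : ℝ)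

/-- The integral closure `Ī = {α ∈ ℕ^n : ∃ r > 0, r·α ∈ rI}` of a monoid ideal `I ⊆ ℕ^n`. -/
def intCl (n : ℕ) (I : Set (Fin n → ℕ)) : Set (Fin n → ℕ) :=
  {α | ∃ r : ℕ, 0 < r ∧ r • α ∈ rFold r I}

/-- The Newton polyhedron `New(I) = conv(I) ⊆ ℝ^n`. -/
def newton (n : ℕ) (I : Set (Fin n → ℕ)) : Set (Fin n → ℝ) :=
  convexHull ℝ (natToReal n '' I)

theorem rFold_eq_nsmul {α : Type*} [AddCommMonoid α] (r : ℕ) (I : Set α) :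
    rFold r I = r • I := by
  induction r with
  | zero => rw [zero_nsmul, rFold, Set.singleton_zero]
  | succ k ih => rw [succ_nsmul', ← ih, rFold]

theorem sum_nsmul_mem_rFold {α ι : Type*} [AddCommMonoid α] {I : Set α} (s : Finset ι)
    (m : ι → ℕ) (p : ι → α) (hp : ∀ i, p i ∈ I) :
    ∑ i ∈ s, m i • p i ∈ rFold (∑ i ∈ s, m i) I := by
  classical
  induction s using Finset.induction_on with
  | empty => simp [rFold]
  | insert i s hi ih =>
    rw [rFold_eq_nsmul] at ih ⊢
    rw [Finset.sum_insert hi, Finset.sum_insert hi, add_nsmul]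
    exact Set.add_mem_add (Set.nsmul_mem_nsmul (hp i)) ih

theorem natToReal_mem_smul_newton {n : ℕ} {I : Set (Fin n → ℕ)} (hI : I.Nonempty) (r : ℕ)
    {x : Fin n → ℕ} (hx : x ∈ rFold r I) : natToReal n x ∈ (r : ℝ) • newton n I := by
  induction r generalizing x with
  | zero =>
    obtain ⟨a, ha⟩ := hI
    obtain rfl : x = 0 := hx
    refine ⟨natToReal n a, subset_convexHull ℝ _ ⟨a, ha, rfl⟩, ?_⟩
    ext i
    simp [natToReal]
  | succ k ih =>
    obtain ⟨a, ha, b, hb, rfl⟩ := hx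
    rw [Nat.cast_succ, add_comm, newton,
      (convex_convexHull ℝ _).add_smul zero_le_one (Nat.cast_nonneg k)]
    refine ⟨natToReal n a, ?_, natToReal n b, ih hb, ?_⟩
    · rw [one_smul]
      exact subset_convexHull ℝ _ ⟨a, ha, rfl⟩
    · ext i
      simp [natToReal]

/-- Affine coordinates of a rational point with respect to affinely independent rational points
are rational. -/
theorem AffineIndependent.exists_rat_weights {ι κ : Type*} [Fintype ι] {z : ι → κ → ℝ}
    (hz : AffineIndependent ℝ z) {p : ι → κ → ℚ} (hp : ∀ i k, z i k = p i k)
    {w : ι → ℝ} (hw : ∑ i, w i = 1) {a : κ → ℚ} (ha : ∀ k, (∑ i, w i • z i) k = a k) :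
    ∃ q : ι → ℚ, ∀ i, w i = q i := by
  obtain ⟨φ, hφ⟩ := (Algebra.linearMap ℚ ℝ).exists_leftInverse_of_injective
    (LinearMap.ker_eq_bot.2 (algebraMap ℚ ℝ).injective)
  have hφ_rat (q : ℚ) : φ (q : ℝ) = q := by
    simpa using LinearMap.congr_fun hφ q
  have hφ_mul (x : ℝ) (q : ℚ) : φ (x * q) = φ x * q := by
    rw [mul_comm, ← Rat.smul_def, map_smul, smul_eq_mul, mul_comm]
  have hsum : ∑ i, φ (w i) = 1 := by
    rw [← map_sum, hw]
    simpa using hφ_rat 1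
  have hcomb (k : κ) : ∑ i, φ (w i) * p i k = a k := by
    rw [← hφ_rat (a k), ← ha k]
    simp [Finset.sum_apply, hp, hφ_mul]
  refine ⟨fun i => φ (w i), fun i => sub_eq_zero.1 ?_⟩
  refine affineIndependent_iff.1 hz Finset.univ (fun i => w i - (φ (w i) : ℝ)) ?_ ?_ i
    (Finset.mem_univ i)
  · rw [Finset.sum_sub_distrib, hw, ← Rat.cast_sum, hsum]
    simp
  · simp only [sub_smul, Finset.sum_sub_distrib]
    ext k
    rw [Pi.sub_apply, ha k, ← hcomb k]
    simp [Finset.sum_apply, hp]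

theorem exists_common_denominator {ι : Type*} [Fintype ι] (q : ι → ℚ) (hq : ∀ i, 0 ≤ q i) :
    ∃ d : ℕ, 0 < d ∧ ∃ m : ι → ℕ, ∀ i, (m i : ℚ) = d * q i := by
  refine ⟨∏ i, (q i).den, Finset.prod_pos fun i _ => (q i).den_pos, ?_⟩
  suffices h : ∀ i, ∃ m : ℕ, (m : ℚ) = (∏ j, (q j).den : ℕ) * q i from
    ⟨fun i => (h i).choose, fun i => (h i).choose_spec⟩
  intro i
  obtain ⟨c, hc⟩ := Finset.dvd_prod_of_mem (fun j => (q j).den) (Finset.mem_univ i)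
  refine ⟨c * (q i).num.toNat, ?_⟩
  have hnum : (((q i).num.toNat : ℕ) : ℚ) = (q i).num := by
    exact_mod_cast Int.toNat_of_nonneg (Rat.num_nonneg.2 (hq i))
  rw [hc, Nat.cast_mul, Nat.cast_mul, hnum, ← Rat.den_mul_eq_num]
  ring

/-- If `I ⊆ ℕ^n` is a monoid ideal, then `Ī = New(I) ∩ ℕ^n`. -/
theorem stmt0 (n : ℕ) (I : Set (Fin n → ℕ))
    (hI : I + (Set.univ : Set (Fin n → ℕ)) = I) :
    intCl n I = {α | natToReal n α ∈ newton n I} := by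
  ext α
  constructor
  · rintro ⟨r, hr, hα⟩
    have hne : I.Nonempty := by
      obtain ⟨k, rfl⟩ := Nat.exists_eq_succ_of_ne_zero hr.ne'
      obtain ⟨a, ha, -⟩ := hα
      exact ⟨a, ha⟩
    obtain ⟨y, hy, hyα⟩ := natToReal_mem_smul_newton hne r hα
    have hr' : (r : ℝ) ≠ 0 := Nat.cast_ne_zero.2 hr.ne'
    have : natToReal n α = y := by
      ext i
      have := congrFun hyα i
      simp only [natToReal, Pi.smul_apply, smul_eq_mul, Nat.cast_mul] at this
      exact (mul_left_cancel₀ hr' this).symm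
    rw [Set.mem_ofPred_eq, this]
    exact hy
  · intro hα
    obtain ⟨ι, _, z, w, hzI, hz, hw0, hw1, hwz⟩ := eq_pos_convex_span_of_mem_convexHull hα
    choose p hpI hpz using fun i => hzI ⟨i, rfl⟩
    have hzp (i : ι) (k : Fin n) : z i k = p i k := by rw [← hpz i]; rfl
    obtain ⟨q, hq⟩ := hz.exists_rat_weights (p := fun i k => (p i k : ℚ)) (by simpa using hzp)
      hw1 (a := fun k => (α k : ℚ)) (fun k => by rw [hwz]; simp [natToReal])
    obtain ⟨d, hd, m, hm⟩ := exists_common_denominator q fun i => by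
      exact_mod_cast (hq i ▸ hw0 i).le
    have hmw (i : ι) : (m i : ℝ) = d * w i := by
      rw [hq i]
      exact_mod_cast hm i
    have hmd : ∑ i, m i = d := by
      have : (∑ i, (m i : ℝ)) = d := by simp only [hmw, ← Finset.mul_sum, hw1, mul_one]
      exact_mod_cast this
    have hmα : ∑ i, m i • p i = d • α := by
      ext k
      have : (∑ i, (m i : ℝ) * p i k) = d * α k := by
        have hk := congrFun hwz k
        simp only [Finset.sum_apply, Pi.smul_apply, smul_eq_mul, hzp, natToReal] at hk
        simp only [hmw, mul_assoc, ← Finset.mul_sum, hk]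
      simp only [Finset.sum_apply, Pi.smul_apply, smul_eq_mul]
      exact_mod_cast this
    exact ⟨d, hd, hmα ▸ hmd ▸ sum_nsmul_mem_rFold Finset.univ m p hpI⟩
end

section
/- Let S ⊆ ℤ^n satisfy S + ℕ^n = S. Then the following three conditions are equivalent: (1) S is generated by its minimal elements, i.e. every s ∈ S satisfies m ≤ s for some m ∈ S that is minimal in S with respect to the componentwise partial order; (2) there is no infinite strictly decreasing (with respect to the componentwise partial order) sequence of elements of S; (3) for every b ∈ ℤ^n, the set {s ∈ S : s ≤ b componentwise} is finite. -/
open scoped Pointwise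

/-- `ℕ^n` as a subset of `ℤ^n`. -/
def nonnegOrthant (n : ℕ) : Set (Fin n → ℤ) := {v | ∀ i, 0 ≤ v i}

/-- If a property of points of an order can always be propagated to a smaller point,
then it holds along an infinite strictly decreasing sequence. -/
theorem exists_strictly_decreasing_seq {α : Type*} [Preorder α] {p : α → Prop} {a : α}
    (ha : p a) (h : ∀ x, p x → ∃ y, p y ∧ y < x) :
    ∃ f : ℕ → α, (∀ k, p (f k)) ∧ ∀ k, f (k + 1) < f k := by
  choose g hgp hglt using h
  let F : ℕ → {x // p x} := fun k => (fun x => ⟨g x.1 x.2, hgp x.1 x.2⟩)^[k] ⟨a, ha⟩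
  refine ⟨fun k => (F k).1, fun k => (F k).2, fun k => ?_⟩
  simp only [F, Function.iterate_succ_apply']
  exact hglt _ _

/-- Dickson's lemma with the order reversed: an antichain in `ℤ^ι` bounded above is finite. -/
theorem finite_of_isAntichain_of_bddAbove {ι : Type*} [Finite ι] {M : Set (ι → ℤ)}
    (hM : IsAntichain (· ≤ ·) M) (hb : BddAbove M) : M.Finite := by
  obtain ⟨b, hb⟩ := hb
  by_contra hinf
  let f := Set.Infinite.natEmbedding M hinf
  obtain ⟨k, l, hkl, hle⟩ := wellQuasiOrdered_le
    (fun (k : ℕ) (i : ι) => (b i - (f k).1 i).toNat)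
  have hfle : (f l).1 ≤ (f k).1 := fun i => by
    have h₁ : (b i - (f k).1 i).toNat ≤ (b i - (f l).1 i).toNat := hle i
    have h₂ : (f k).1 i ≤ b i := hb (f k).2 i
    have h₃ : (f l).1 i ≤ b i := hb (f l).2 i
    show (f l).1 i ≤ (f k).1 i
    omega
  have heq := hM.eq (f l).2 (f k).2 hfle
  exact hkl.ne' (f.injective (Subtype.ext heq))

/-- For `S ⊆ ℤ^n` with `S + ℕ^n = S`, the following are equivalent (such `S` are called
co-artinian): (1) every element of `S` lies above a minimal element of `S`;
(2) there is no infinite strictly decreasing sequence in `S`;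
(3) for every `b ∈ ℤ^n` the set of elements of `S` below `b` is finite.
The partial order is the componentwise one. -/
theorem stmt4 (n : ℕ) (S : Set (Fin n → ℤ))
    (hS : S + nonnegOrthant n = S) :
    ((∀ s ∈ S, ∃ m ∈ S, m ≤ s ∧ ∀ x ∈ S, x ≤ m → x = m) ↔
      ¬ ∃ f : ℕ → (Fin n → ℤ), (∀ k, f k ∈ S) ∧ ∀ k, f (k + 1) < f k) ∧
    ((¬ ∃ f : ℕ → (Fin n → ℤ), (∀ k, f k ∈ S) ∧ ∀ k, f (k + 1) < f k) ↔
      ∀ b : Fin n → ℤ, {s ∈ S | s ≤ b}.Finite) := by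
  have min_of_dcc : (¬ ∃ f : ℕ → (Fin n → ℤ), (∀ k, f k ∈ S) ∧ ∀ k, f (k + 1) < f k) →
      ∀ s ∈ S, ∃ m ∈ S, m ≤ s ∧ ∀ x ∈ S, x ≤ m → x = m := by
    intro hdcc s hs
    by_contra! hmin
    obtain ⟨f, hf, hlt⟩ := exists_strictly_decreasing_seq (p := fun t => t ∈ S ∧ t ≤ s)
      ⟨hs, le_rfl⟩ fun t ht => by
        obtain ⟨x, hx, hxt, hne⟩ := hmin t ht.1 ht.2
        exact ⟨x, ⟨hx, hxt.trans ht.2⟩, lt_of_le_of_ne hxt hne⟩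
    exact hdcc ⟨f, fun k => (hf k).1, hlt⟩
  have finite_of_min : (∀ s ∈ S, ∃ m ∈ S, m ≤ s ∧ ∀ x ∈ S, x ≤ m → x = m) →
      ∀ b : Fin n → ℤ, {s ∈ S | s ≤ b}.Finite := by
    intro hmin b
    have hM : {m ∈ S | m ≤ b ∧ ∀ x ∈ S, x ≤ m → x = m}.Finite :=
      finite_of_isAntichain_of_bddAbove
        (fun x hx y hy hne hxy => hne (hy.2.2 x hx.1 hxy)) ⟨b, fun m hm => hm.2.1⟩
    refine (hM.biUnion fun m _ => Set.finite_Icc m b).subset ?_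
    rintro s ⟨hs, hsb⟩
    obtain ⟨m, hm, hms, hm_min⟩ := hmin s hs
    exact Set.mem_iUnion₂.2 ⟨m, ⟨hm, hms.trans hsb, hm_min⟩, hms, hsb⟩
  have dcc_of_finite : (∀ b : Fin n → ℤ, {s ∈ S | s ≤ b}.Finite) →
      ¬ ∃ f : ℕ → (Fin n → ℤ), (∀ k, f k ∈ S) ∧ ∀ k, f (k + 1) < f k := by
    rintro hfin ⟨f, hf, hlt⟩
    have hanti : StrictAnti f := strictAnti_nat_of_succ_lt hlt
    have hmem : ∀ k, f k ∈ {s ∈ S | s ≤ f 0} :=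
      fun k => ⟨hf k, hanti.antitone (Nat.zero_le k)⟩
    exact Set.infinite_of_injective_forall_mem hanti.injective hmem (hfin (f 0))
  exact ⟨⟨fun h => dcc_of_finite (finite_of_min h), min_of_dcc⟩,
    ⟨fun h => finite_of_min (min_of_dcc h), dcc_of_finite⟩⟩
end

section
/- Let r, s be coprime positive integers. Then New(E_{r/s}) is simple: whenever New(E_{r/s}) = P + Q (Minkowski sum) with P and Q both lattice polyhedra with recession cone ℝ₊², at least one of P, Q is a translate by an integer vector of ℝ₊². -/
open scoped Pointwise

/-- The inclusion `ℤ² ⊆ ℝ²`. -/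
def intVec (a : ℤ × ℤ) : ℝ × ℝ := ((a.1 : ℝ), (a.2 : ℝ))

/-- The closed positive quadrant `ℝ₊²`. -/
def Quadrant : Set (ℝ × ℝ) := {p | 0 ≤ p.1 ∧ 0 ≤ p.2}

/-- A lattice polyhedron with recession cone `ℝ₊²`: a nonempty `P ⊆ ℝ²` with
`P = conv(P ∩ ℤ²)` and recession cone exactly `ℝ₊²`. -/
def IsLatticePolyhedron (P : Set (ℝ × ℝ)) : Prop :=
  P.Nonempty ∧ P = convexHull ℝ (P ∩ Set.range intVec) ∧
  {d : ℝ × ℝ | ∀ p ∈ P, ∀ t : ℝ, 0 ≤ t → p + t • d ∈ P} = Quadrant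

/-- `New(E_{r/s}) = {(x,y) ∈ ℝ₊² : s·x + r·y ≥ r·s}`. -/
def NewE (r s : ℕ) : Set (ℝ × ℝ) :=
  {p | 0 ≤ p.1 ∧ 0 ≤ p.2 ∧ (r : ℝ) * s ≤ s * p.1 + r * p.2}

theorem mem_extremePoints_of_add_mem_extremePoints {E : Type*} [AddCommGroup E] [Module ℝ E]
    {A B : Set E} {a b : E} (ha : a ∈ A) (hb : b ∈ B)
    (h : a + b ∈ (A + B).extremePoints ℝ) : a ∈ A.extremePoints ℝ := by
  refine mem_extremePoints.2 ⟨ha, ?_⟩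
  rintro x hx y hy ⟨t, u, ht, hu, htu, rfl⟩
  have key := (mem_extremePoints.1 h).2 (x + b) (Set.add_mem_add hx hb) (y + b)
    (Set.add_mem_add hy hb) ⟨t, u, ht, hu, htu, by
      rw [smul_add, smul_add, add_add_add_comm, ← add_smul, htu, one_smul]⟩
  exact ⟨add_right_cancel key.1, add_right_cancel key.2⟩

theorem IsLatticePolyhedron.extremePoints_subset {P : Set (ℝ × ℝ)} (hP : IsLatticePolyhedron P) :
    P.extremePoints ℝ ⊆ Set.range intVec := by
  intro p hp
  rw [hP.2.1] at hp
  exact (extremePoints_convexHull_subset hp).2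

theorem IsLatticePolyhedron.eq_singleton_add_quadrant {P : Set (ℝ × ℝ)}
    (hP : IsLatticePolyhedron P) {v : ℝ × ℝ} (hv : v ∈ P)
    (hmin : ∀ p ∈ P, v.1 ≤ p.1 ∧ v.2 ≤ p.2) : P = {v} + Quadrant := by
  ext p
  rw [Set.singleton_add, Set.mem_image]
  constructor
  · intro hp
    exact ⟨p - v, ⟨sub_nonneg.2 (hmin p hp).1, sub_nonneg.2 (hmin p hp).2⟩,
      add_sub_cancel v p⟩
  · rintro ⟨d, hd, rfl⟩
    rw [← hP.2.2] at hd
    simpa using hd v hv 1 zero_le_one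

theorem right_mem_extremePoints_newE {r s : ℕ} (hs : 0 < s) :
    ((r : ℝ), (0 : ℝ)) ∈ (NewE r s).extremePoints ℝ := by
  have hs' : (0 : ℝ) < s := by exact_mod_cast hs
  refine mem_extremePoints.2 ⟨⟨by positivity, le_rfl, by simp [mul_comm]⟩, ?_⟩
  rintro ⟨x, y⟩ ⟨-, hy, hxy⟩ ⟨x', y'⟩ ⟨-, hy', hxy'⟩ ⟨t, u, ht, hu, htu, h⟩
  simp only [Prod.smul_mk, Prod.mk_add_mk, Prod.mk.injEq, smul_eq_mul] at h hy hy' hxy hxy' ⊢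
  obtain ⟨h₁, h₂⟩ := h
  have hy0 : y = 0 := by nlinarith [mul_nonneg ht.le hy, mul_nonneg hu.le hy']
  have hy0' : y' = 0 := by nlinarith [mul_nonneg ht.le hy, mul_nonneg hu.le hy']
  subst hy0 hy0'
  have hx : (r : ℝ) ≤ x := by nlinarith
  have hx' : (r : ℝ) ≤ x' := by nlinarith
  have hu' : u = 1 - t := by linarith
  subst hu'
  refine ⟨⟨le_antisymm ?_ hx, rfl⟩, le_antisymm ?_ hx', rfl⟩
  · nlinarith [mul_nonneg hu.le (sub_nonneg.2 hx')]
  · nlinarith [mul_nonneg ht.le (sub_nonneg.2 hx)]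

theorem left_mem_extremePoints_newE {r s : ℕ} (hr : 0 < r) :
    ((0 : ℝ), (s : ℝ)) ∈ (NewE r s).extremePoints ℝ := by
  have hr' : (0 : ℝ) < r := by exact_mod_cast hr
  refine mem_extremePoints.2 ⟨⟨le_rfl, by positivity, by simp⟩, ?_⟩
  rintro ⟨x, y⟩ ⟨hx, -, hxy⟩ ⟨x', y'⟩ ⟨hx', -, hxy'⟩ ⟨t, u, ht, hu, htu, h⟩
  simp only [Prod.smul_mk, Prod.mk_add_mk, Prod.mk.injEq, smul_eq_mul] at h hx hx' hxy hxy' ⊢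
  obtain ⟨h₁, h₂⟩ := h
  have hx0 : x = 0 := by nlinarith [mul_nonneg ht.le hx, mul_nonneg hu.le hx']
  have hx0' : x' = 0 := by nlinarith [mul_nonneg ht.le hx, mul_nonneg hu.le hx']
  subst hx0 hx0'
  have hy : (s : ℝ) ≤ y := by nlinarith
  have hy' : (s : ℝ) ≤ y' := by nlinarith
  have hu' : u = 1 - t := by linarith
  subst hu'
  refine ⟨⟨rfl, le_antisymm ?_ hy⟩, rfl, le_antisymm ?_ hy'⟩
  · nlinarith [mul_nonneg hu.le (sub_nonneg.2 hy')]
  · nlinarith [mul_nonneg ht.le (sub_nonneg.2 hy)]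

/-- `New(E_{r/s})` is simple: whenever it is a Minkowski sum of two lattice polyhedra
with recession cone `ℝ₊²`, one of the summands is an integer translate of `ℝ₊²`. -/
theorem stmt7 (r s : ℕ) (hr : 0 < r) (hs : 0 < s) (hco : Nat.Coprime r s)
    (P Q : Set (ℝ × ℝ)) (hP : IsLatticePolyhedron P) (hQ : IsLatticePolyhedron Q)
    (hPQ : NewE r s = P + Q) :
    (∃ v : ℤ × ℤ, P = {intVec v} + Quadrant) ∨
    (∃ v : ℤ × ℤ, Q = {intVec v} + Quadrant) := by
  have hr' : (0 : ℝ) < r := by exact_mod_cast hr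
  have hs' : (0 : ℝ) < s := by exact_mod_cast hs
  have lattice : ∀ e ∈ (NewE r s).extremePoints ℝ,
      ∃ a b : ℤ × ℤ, intVec a ∈ P ∧ intVec b ∈ Q ∧ intVec a + intVec b = e := by
    intro e he
    have he' := he.1
    rw [hPQ] at he he'
    obtain ⟨p, hp, q, hq, rfl⟩ := he'
    obtain ⟨a, rfl⟩ := hP.extremePoints_subset
      (mem_extremePoints_of_add_mem_extremePoints hp hq he)
    obtain ⟨b, rfl⟩ := hQ.extremePoints_subset
      (mem_extremePoints_of_add_mem_extremePoints hq hp (by rwa [add_comm q, add_comm Q]))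
    exact ⟨a, b, hp, hq, rfl⟩
  have hmem : ∀ p ∈ P, ∀ q ∈ Q, 0 ≤ p.1 + q.1 ∧ 0 ≤ p.2 + q.2 ∧
      (r : ℝ) * s ≤ s * (p.1 + q.1) + r * (p.2 + q.2) := by
    intro p hp q hq
    have h : p + q ∈ NewE r s := hPQ ▸ Set.add_mem_add hp hq
    exact h
  obtain ⟨a, b, ha, hb, hab⟩ := lattice _ (right_mem_extremePoints_newE hs)
  obtain ⟨c, d, hc, hd, hcd⟩ := lattice _ (left_mem_extremePoints_newE hr)
  have hab₁ : (a.1 : ℝ) + b.1 = r := congrArg Prod.fst hab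
  have hab₂ : (a.2 : ℝ) + b.2 = 0 := congrArg Prod.snd hab
  have hcd₁ : (c.1 : ℝ) + d.1 = 0 := congrArg Prod.fst hcd
  have hcd₂ : (c.2 : ℝ) + d.2 = s := congrArg Prod.snd hcd
  obtain ⟨-, had₂, had⟩ := hmem _ ha _ hd
  obtain ⟨-, hcb₂, hcb⟩ := hmem _ hc _ hb
  simp only [intVec] at had₂ had hcb₂ hcb
  have hlevel : (s : ℝ) * (a.1 - c.1) = r * (c.2 - a.2) := by
    have hb₁ : (b.1 : ℝ) = r - a.1 := by linarith
    have hb₂ : (b.2 : ℝ) = -a.2 := by linarith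
    have hd₁ : (d.1 : ℝ) = -c.1 := by linarith
    have hd₂ : (d.2 : ℝ) = s - c.2 := by linarith
    rw [hd₁, hd₂] at had
    rw [hb₁, hb₂] at hcb
    apply le_antisymm <;> nlinarith
  have hlevel' : (s : ℤ) * (a.1 - c.1) = r * (c.2 - a.2) := by exact_mod_cast hlevel
  obtain ⟨k, hk⟩ : (s : ℤ) ∣ c.2 - a.2 :=
    (Nat.isCoprime_iff_coprime.2 hco).symm.dvd_of_dvd_mul_left ⟨_, hlevel'.symm⟩
  have hsZ : (0 : ℤ) < s := by exact_mod_cast hs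
  have hk' : a.1 - c.1 = r * k := by
    rw [hk] at hlevel'
    exact mul_left_cancel₀ hsZ.ne' (by rw [hlevel']; ring)
  have had₂' : 0 ≤ a.2 + d.2 := by exact_mod_cast had₂
  have hcb₂' : 0 ≤ c.2 + b.2 := by exact_mod_cast hcb₂
  have hab₁' : a.1 + b.1 = r := by exact_mod_cast hab₁
  have hab₂' : a.2 + b.2 = 0 := by exact_mod_cast hab₂
  have hcd₁' : c.1 + d.1 = 0 := by exact_mod_cast hcd₁
  have hcd₂' : c.2 + d.2 = s := by exact_mod_cast hcd₂
  have hk₀ : 0 ≤ k := by nlinarith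
  have hk₁ : k ≤ 1 := by nlinarith
  obtain rfl | rfl : k = 0 ∨ k = 1 := by omega
  · have hac : c = a := by ext <;> linarith
    subst hac
    refine .inl ⟨c, hP.eq_singleton_add_quadrant hc fun p hp => ?_⟩
    have h₁ := (hmem p hp _ hd).1
    have h₂ := (hmem p hp _ hb).2.1
    simp only [intVec] at h₁ h₂ ⊢
    constructor <;> linarith
  · have hbd : d = b := by ext <;> linarith
    subst hbd
    refine .inr ⟨d, hQ.eq_singleton_add_quadrant hd fun q hq => ?_⟩
    have h₁ := (hmem _ hc q hq).1
    have h₂ := (hmem _ ha q hq).2.1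
    simp only [intVec] at h₁ h₂ ⊢
    constructor <;> linarith
end

section
/- Minkowski addition is continuous for the convergence of lattice polyhedra: if (P_i) and (Q_i) are sequences of lattice polyhedra with recession cone ℝ₊² converging to lattice polyhedra P and Q respectively (each with recession cone ℝ₊²), then the sequence of Minkowski sums (P_i + Q_i) converges to P + Q. -/
open scoped Pointwise

/-- A sequence `(Ps i)` of subsets of `ℝ²` converges to `P` if there are translation
vectors `β : ℕ → ℤ²` such that for every `α ∈ ℤ²` there is `N` with:
for all `i > N`, `β(i) + α ∈ Ps i` iff `α ∈ P`. -/
def SeqConverges (Ps : ℕ → Set (ℝ × ℝ)) (P : Set (ℝ × ℝ)) : Prop :=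
  ∃ β : ℕ → ℤ × ℤ, ∀ α : ℤ × ℤ, ∃ N : ℕ, ∀ i, N < i →
    (intVec (β i + α) ∈ Ps i ↔ intVec α ∈ P)

section

open Filter Topology

theorem quadrant_translate_mem {P : Set (ℝ × ℝ)} (hP : IsLatticePolyhedron P) {p q : ℝ × ℝ}
    (hp : p ∈ P) (h₁ : p.1 ≤ q.1) (h₂ : p.2 ≤ q.2) : q ∈ P := by
  have hd : q - p ∈ Quadrant := ⟨sub_nonneg.2 h₁, sub_nonneg.2 h₂⟩
  rw [← hP.2.2] at hd
  simpa using hd p hp 1 zero_le_one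

theorem IsLatticePolyhedron.convex {P : Set (ℝ × ℝ)} (hP : IsLatticePolyhedron P) :
    Convex ℝ P := by
  rw [hP.2.1]
  exact convex_convexHull ℝ _

theorem intVec_add (a b : ℤ × ℤ) : intVec (a + b) = intVec a + intVec b := by
  simp [intVec]

theorem intVec_neg (a : ℤ × ℤ) : intVec (-a) = -intVec a := by
  simp [intVec]

theorem IsLatticePolyhedron.vadd {P : Set (ℝ × ℝ)} (hP : IsLatticePolyhedron P) (b : ℤ × ℤ) :
    IsLatticePolyhedron (intVec b +ᵥ P) := by
  refine ⟨hP.1.vadd_set, ?_, ?_⟩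
  · have h : (intVec b +ᵥ P) ∩ Set.range intVec = intVec b +ᵥ (P ∩ Set.range intVec) := by
      rw [Set.vadd_set_inter]
      congr 1
      ext x
      rw [Set.mem_vadd_set_iff_neg_vadd_mem]
      constructor
      · rintro ⟨a, rfl⟩
        exact ⟨-b + a, by simp [intVec_add, intVec_neg]⟩
      · rintro ⟨a, ha⟩
        exact ⟨b + a, by rw [intVec_add, ha]; simp⟩
    rw [h, convexHull_vadd, ← hP.2.1]
  · rw [← hP.2.2]
    ext d
    simp only [Set.mem_ofPred_eq, Set.mem_vadd_set_iff_neg_vadd_mem, vadd_eq_add]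
    constructor
    · intro h p hp t ht
      simpa [add_assoc] using h (intVec b + p) (by simpa using hp) t ht
    · intro h p hp t ht
      simpa [add_assoc] using h _ hp t ht

/-- A direction outside the recession cone leaves the polyhedron from every base point. -/
theorem exists_nat_smul_notMem {P : Set (ℝ × ℝ)} (hP : IsLatticePolyhedron P) {c d : ℝ × ℝ}
    (hd : d ∉ Quadrant) : ∃ k : ℕ, c + (k : ℝ) • d ∉ P := by
  by_contra! h
  obtain ⟨ε, hε, hdε⟩ : ∃ ε : ℝ, 0 < ε ∧ d + (ε, ε) ∉ Quadrant := by
    by_cases h1 : d.1 < 0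
    · refine ⟨-d.1 / 2, by linarith, fun hq => ?_⟩
      have := hq.1
      simp only [Prod.fst_add] at this
      linarith
    · have h2 : d.2 < 0 := by
        by_contra h2
        exact hd ⟨not_lt.1 h1, not_lt.1 h2⟩
      refine ⟨-d.2 / 2, by linarith, fun hq => ?_⟩
      have := hq.2
      simp only [Prod.snd_add] at this
      linarith
  apply hdε
  rw [← hP.2.2]
  intro p hp t ht
  obtain ⟨k, hk⟩ := exists_nat_gt (t + |c.1 - p.1| / ε + |c.2 - p.2| / ε)
  have e1 : 0 ≤ |c.1 - p.1| / ε := by positivity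
  have e2 : 0 ≤ |c.2 - p.2| / ε := by positivity
  have hk0 : (0 : ℝ) < k := by linarith
  have b1 : |c.1 - p.1| ≤ k * ε := by
    rw [← div_le_iff₀ hε]; linarith
  have b2 : |c.2 - p.2| ≤ k * ε := by
    rw [← div_le_iff₀ hε]; linarith
  have hl : 0 ≤ t / k := by positivity
  have hl1 : t / k ≤ 1 := by rw [div_le_one hk0]; linarith
  have hm := hP.convex hp (h k) (sub_nonneg.2 hl1) hl (by ring)
  have ht' : t / k * k = t := by field_simp
  have c1 : t / k * (c.1 - p.1) ≤ t / k * (k * ε) :=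
    mul_le_mul_of_nonneg_left ((le_abs_self _).trans b1) hl
  have c2 : t / k * (c.2 - p.2) ≤ t / k * (k * ε) :=
    mul_le_mul_of_nonneg_left ((le_abs_self _).trans b2) hl
  rw [← mul_assoc, ht'] at c1 c2
  refine quadrant_translate_mem hP hm ?_ ?_
  · simp only [Prod.fst_add, Prod.smul_fst, smul_eq_mul]
    linear_combination c1 + d.1 * ht'
  · simp only [Prod.snd_add, Prod.smul_snd, smul_eq_mul]
    linear_combination c2 + d.2 * ht'

/-- Two excluded points on steep rays from `c` give linear lower bounds. -/
theorem linear_bounds {P : Set (ℝ × ℝ)} (hP : IsLatticePolyhedron P) {c : ℝ × ℝ} (hc : c ∈ P)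
    {s : ℝ} (hs : 1 ≤ s) {k l : ℕ} (hk : c + (k : ℝ) • ((-1 : ℝ), s) ∉ P)
    (hl : c + (l : ℝ) • (s, (-1 : ℝ)) ∉ P) {p : ℝ × ℝ} (hp : p ∈ P) :
    s * c.1 + c.2 - s * (k + l) ≤ s * p.1 + p.2 ∧
      c.1 + s * c.2 - s * (k + l) ≤ p.1 + s * p.2 := by
  have hk0 : (0 : ℝ) ≤ k := k.cast_nonneg
  have hl0 : (0 : ℝ) ≤ l := l.cast_nonneg
  have hsk : (k : ℝ) ≤ s * k := le_mul_of_one_le_left hk0 hs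
  have hsl : (l : ℝ) ≤ s * l := le_mul_of_one_le_left hl0 hs
  have h1 : c.1 - p.1 ≤ k ∨ s * (c.1 - p.1) ≤ p.2 - c.2 := by
    by_contra! h
    have hu : 0 < c.1 - p.1 := hk0.trans_lt h.1
    have hm := hP.convex hc hp (a := 1 - k / (c.1 - p.1)) (b := k / (c.1 - p.1))
      (sub_nonneg.2 ((div_le_one hu).2 h.1.le)) (by positivity) (by ring)
    have e : k / (c.1 - p.1) * (c.1 - p.1) = (k : ℝ) := div_mul_cancel₀ _ hu.ne'
    have e0 : (0 : ℝ) ≤ k / (c.1 - p.1) := by positivity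
    have e2 := mul_le_mul_of_nonneg_left h.2.le e0
    refine hk (quadrant_translate_mem hP hm ?_ ?_)
    · simp only [Prod.fst_add, Prod.smul_fst, smul_eq_mul]
      linear_combination -e
    · simp only [Prod.snd_add, Prod.smul_snd, smul_eq_mul]
      linear_combination e2 + s * e
  have h2 : c.2 - p.2 ≤ l ∨ s * (c.2 - p.2) ≤ p.1 - c.1 := by
    by_contra! h
    have hu : 0 < c.2 - p.2 := hl0.trans_lt h.1
    have hm := hP.convex hc hp (a := 1 - l / (c.2 - p.2)) (b := l / (c.2 - p.2))
      (sub_nonneg.2 ((div_le_one hu).2 h.1.le)) (by positivity) (by ring)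
    have e : l / (c.2 - p.2) * (c.2 - p.2) = (l : ℝ) := div_mul_cancel₀ _ hu.ne'
    have e0 : (0 : ℝ) ≤ l / (c.2 - p.2) := by positivity
    have e2 := mul_le_mul_of_nonneg_left h.2.le e0
    refine hl (quadrant_translate_mem hP hm ?_ ?_)
    · simp only [Prod.fst_add, Prod.smul_fst, smul_eq_mul]
      linear_combination e2 + s * e
    · simp only [Prod.snd_add, Prod.smul_snd, smul_eq_mul]
      linear_combination -e
  rcases le_or_gt (c.1 - p.1) k with a1 | a1
  · rcases le_or_gt (c.2 - p.2) l with a2 | a2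
    · constructor <;> nlinarith
    · have a3 := h2.resolve_left a2.not_ge
      constructor <;> nlinarith
  · have a3 := h1.resolve_left a1.not_ge
    have hu : 0 ≤ c.1 - p.1 := hk0.trans a1.le
    have a4 := mul_le_mul_of_nonneg_left a3 (zero_le_one.trans hs)
    have a5 := mul_le_mul_of_nonneg_left (one_le_mul_of_one_le_of_one_le hs hs) hu
    constructor <;> linarith

variable {ι : Type*}

theorem eventually_linear_bounds {F : Filter ι} {Ps : ι → Set (ℝ × ℝ)} {P : Set (ℝ × ℝ)}
    (hPs : ∀ i, IsLatticePolyhedron (Ps i)) (hP : IsLatticePolyhedron P)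
    (h : ∀ α, ∀ᶠ i in F, (intVec α ∈ Ps i ↔ intVec α ∈ P)) (s : ℕ) (hs : 1 ≤ s) :
    ∃ C : ℝ, 0 ≤ C ∧ ∀ᶠ i in F, ∀ p ∈ Ps i, -C ≤ s * p.1 + p.2 ∧ -C ≤ p.1 + s * p.2 := by
  obtain ⟨_, hc, c, rfl⟩ : (P ∩ Set.range intVec).Nonempty := by
    rw [← convexHull_nonempty_iff (𝕜 := ℝ), ← hP.2.1]
    exact hP.1
  obtain ⟨k, hk⟩ := exists_nat_smul_notMem hP (c := intVec c) (d := ((-1 : ℝ), (s : ℝ)))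
    (fun h => absurd h.1 (by norm_num))
  obtain ⟨l, hl⟩ := exists_nat_smul_notMem hP (c := intVec c) (d := ((s : ℝ), (-1 : ℝ)))
    (fun h => absurd h.2 (by norm_num))
  have ek : intVec c + (k : ℝ) • ((-1 : ℝ), (s : ℝ)) = intVec (c + (-(k : ℤ), (k : ℤ) * s)) := by
    simp [intVec]
  have el : intVec c + (l : ℝ) • ((s : ℝ), (-1 : ℝ)) = intVec (c + ((l : ℤ) * s, -(l : ℤ))) := by
    simp [intVec]
  set x := s * (intVec c).1 + (intVec c).2 - s * (k + l)
  set y := (intVec c).1 + s * (intVec c).2 - s * (k + l)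
  refine ⟨|x| + |y|, by positivity, ?_⟩
  filter_upwards [h c, h (c + (-(k : ℤ), (k : ℤ) * s)),
    h (c + ((l : ℤ) * s, -(l : ℤ)))] with i h1 h2 h3 p hp
  rw [← ek] at h2
  rw [← el] at h3
  obtain ⟨b1, b2⟩ := linear_bounds (hPs i) (h1.2 hc) (by exact_mod_cast hs)
    (mt h2.1 hk) (mt h3.1 hl) hp
  have := neg_abs_le x
  have := neg_abs_le y
  have := abs_nonneg x
  have := abs_nonneg y
  exact ⟨by linarith, by linarith⟩

theorem exists_tendsto_of_bounds {U : Ultrafilter ι} {f : ι → ℝ × ℝ} (C M : ℝ)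
    (h : ∀ᶠ i in (U : Filter ι), (-C ≤ 2 * (f i).1 + (f i).2 ∧ -C ≤ (f i).1 + 2 * (f i).2) ∧
      2 * (f i).1 + (f i).2 ≤ M ∧ (f i).1 + 2 * (f i).2 ≤ M) :
    ∃ x, Tendsto f U (𝓝 x) := by
  have hc : IsCompact (Set.Icc (-(2 * C + M) / 3, -(2 * C + M) / 3)
      ((C + 2 * M) / 3, (C + 2 * M) / 3)) := isCompact_Icc
  obtain ⟨x, -, hx⟩ := hc.ultrafilter_le_nhds (U.map f) (by
    rw [le_principal_iff]
    change ∀ᶠ i in (U : Filter ι), f i ∈ _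
    filter_upwards [h] with i hi
    refine ⟨⟨?_, ?_⟩, ⟨?_, ?_⟩⟩ <;> dsimp only <;> linarith [hi.1.1, hi.1.2, hi.2.1, hi.2.2])
  exact ⟨x, hx⟩

theorem exists_fin_three_combination {A : Set (ℤ × ℤ)} {x : ℝ × ℝ}
    (hx : x ∈ convexHull ℝ (intVec '' A)) :
    ∃ (w : Fin 3 → ℝ) (z : Fin 3 → ℤ × ℤ), (∀ j, 0 ≤ w j) ∧ ∑ j, w j = 1 ∧ (∀ j, z j ∈ A) ∧
      ∑ j, w j • intVec (z j) = x := by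
  obtain ⟨κ, _, y, w, hy, hai, hw, hw1, hwx⟩ := eq_pos_convex_span_of_mem_convexHull hx
  have hcard : Fintype.card κ ≤ 3 := by
    have := hai.card_le_finrank_succ
    have h2 := Submodule.finrank_le (vectorSpan ℝ (Set.range y))
    simp at h2
    omega
  obtain ⟨e⟩ : Nonempty (κ ↪ Fin 3) :=
    Function.Embedding.nonempty_of_card_le (by simpa using hcard)
  choose z hzA hz using fun k => hy (Set.mem_range_self k)
  obtain ⟨k₀⟩ : Nonempty κ := by
    by_contra hne
    rw [not_nonempty_iff] at hne
    simp at hw1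
  refine ⟨Function.extend e w 0, Function.extend e z (fun _ => z k₀), ?_, ?_, ?_, ?_⟩
  · intro j
    by_cases hj : ∃ k, e k = j
    · obtain ⟨k, rfl⟩ := hj
      rw [e.injective.extend_apply]
      exact (hw k).le
    · rw [Function.extend_apply' _ _ _ hj]
      exact le_rfl
  · rw [← hw1]
    symm
    apply Fintype.sum_of_injective e e.injective
    · intro j hj
      rw [Function.extend_apply' _ _ _ hj]
      rfl
    · intro k
      rw [e.injective.extend_apply]
  · intro j
    by_cases hj : ∃ k, e k = j
    · obtain ⟨k, rfl⟩ := hj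
      rw [e.injective.extend_apply]
      exact hzA k
    · rw [Function.extend_apply' _ _ _ hj]
      exact hzA k₀
  · rw [← hwx]
    symm
    apply Fintype.sum_of_injective e e.injective
    · intro j hj
      rw [Function.extend_apply' _ _ _ hj]
      simp
    · intro k
      rw [e.injective.extend_apply, e.injective.extend_apply, hz]

theorem eventually_eq_of_tendsto_intVec {F : Filter ι} [F.NeBot] {z : ι → ℤ × ℤ} {x : ℝ × ℝ}
    (h : Tendsto (fun i => intVec (z i)) F (𝓝 x)) :
    ∃ a, x = intVec a ∧ ∀ᶠ i in F, z i = a := by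
  have h1 : Tendsto (fun i => ((z i).1 : ℝ)) F (𝓝 x.1) := (continuous_fst.tendsto x).comp h
  have h2 : Tendsto (fun i => ((z i).2 : ℝ)) F (𝓝 x.2) := (continuous_snd.tendsto x).comp h
  have key : ∀ {f : ι → ℤ} {y : ℝ}, Tendsto (fun i => (f i : ℝ)) F (𝓝 y) →
      ∃ a : ℤ, ∀ᶠ i in F, f i = a := by
    intro f y hf
    have hc := Int.isClosedEmbedding_coe_real.isClosed_range.mem_of_tendsto hf
      (Eventually.of_forall fun i => Set.mem_range_self (f i))
    obtain ⟨a, rfl⟩ := hc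
    have := Int.isClosedEmbedding_coe_real.tendsto_nhds_iff.2 hf
    rw [nhds_discrete, tendsto_pure] at this
    exact ⟨a, this⟩
  obtain ⟨a, ha⟩ := key h1
  obtain ⟨b, hb⟩ := key h2
  have hab : ∀ᶠ i in F, z i = (a, b) := by
    filter_upwards [ha, hb] with i h1 h2 using Prod.ext h1 h2
  refine ⟨(a, b), tendsto_nhds_unique h ?_, hab⟩
  exact tendsto_const_nhds.congr' (hab.mono fun i hi => congrArg intVec hi.symm)

/-- The limit of a weighted sequence of lattice points of `Ps i` is, up to a vector of the
recession cone, the limit weight times a point of `P`. -/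
theorem exists_weighted_limit {U : Ultrafilter ι} {Ps : ι → Set (ℝ × ℝ)} {P : Set (ℝ × ℝ)}
    (hPs : ∀ i, IsLatticePolyhedron (Ps i)) (hP : IsLatticePolyhedron P)
    (h : ∀ α, ∀ᶠ i in (U : Filter ι), (intVec α ∈ Ps i ↔ intVec α ∈ P))
    {w : ι → ℝ} {z : ι → ℤ × ℤ} {w₀ : ℝ} {v : ℝ × ℝ} (hw : ∀ᶠ i in (U : Filter ι), 0 ≤ w i)
    (hz : ∀ᶠ i in (U : Filter ι), intVec (z i) ∈ Ps i) (hw₀ : Tendsto w U (𝓝 w₀))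
    (hv : Tendsto (fun i => w i • intVec (z i)) U (𝓝 v)) :
    ∃ a ∈ P, ∃ d ∈ Quadrant, v = w₀ • a + d := by
  by_cases h0 : w₀ = 0
  · subst h0
    obtain ⟨c, hc⟩ := hP.1
    refine ⟨c, hc, v, ?_, by simp⟩
    have hv1 : Tendsto (fun i => w i * (intVec (z i)).1) U (𝓝 v.1) :=
      (continuous_fst.tendsto v).comp hv
    have hv2 : Tendsto (fun i => w i * (intVec (z i)).2) U (𝓝 v.2) :=
      (continuous_snd.tendsto v).comp hv
    have key : ∀ s : ℕ, 1 ≤ s → 0 ≤ s * v.1 + v.2 ∧ 0 ≤ v.1 + s * v.2 := by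
      intro s hs
      obtain ⟨C, -, hC⟩ := eventually_linear_bounds hPs hP h s hs
      have hl : Tendsto (fun i => w i * -C) U (𝓝 0) := by simpa using hw₀.mul_const (-C)
      constructor
      · refine le_of_tendsto_of_tendsto hl ((hv1.const_mul (s : ℝ)).add hv2) ?_
        filter_upwards [hw, hz, hC] with i h1 h2 h3
        linear_combination mul_le_mul_of_nonneg_left (h3 _ h2).1 h1
      · refine le_of_tendsto_of_tendsto hl (hv1.add (hv2.const_mul (s : ℝ))) ?_
        filter_upwards [hw, hz, hC] with i h1 h2 h3
        linear_combination mul_le_mul_of_nonneg_left (h3 _ h2).2 h1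
    have arch : ∀ x y : ℝ, (∀ s : ℕ, 1 ≤ s → 0 ≤ s * x + y) → 0 ≤ x := by
      intro x y hxy
      by_contra! hx
      obtain ⟨s, hs⟩ := exists_nat_gt (|y| / -x)
      rw [div_lt_iff₀ (by linarith)] at hs
      have := hxy (s + 1) (by omega)
      push_cast at this
      linarith [le_abs_self y]
    exact ⟨arch _ _ fun s hs => (key s hs).1,
      arch _ v.1 fun s hs => by rw [add_comm]; exact (key s hs).2⟩
  · have hlim : Tendsto (fun i => intVec (z i)) U (𝓝 (w₀⁻¹ • v)) := by
      refine ((hw₀.inv₀ h0).smul hv).congr' ?_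
      filter_upwards [hw₀.eventually_ne h0] with i hi
      rw [smul_smul, inv_mul_cancel₀ hi, one_smul]
    obtain ⟨a, ha, hza⟩ := eventually_eq_of_tendsto_intVec hlim
    refine ⟨intVec a, ?_, 0, ⟨le_rfl, le_rfl⟩, ?_⟩
    · obtain ⟨i, h1, h2, h3⟩ := (hza.and (hz.and (h a))).exists
      exact h3.1 (h1 ▸ h2)
    · rw [← ha, smul_smul, mul_inv_cancel₀ h0, one_smul, add_zero]

/-- Limits of points of `Ps i` lie in the limit polyhedron. -/
theorem mem_of_tendsto_of_latticePolyhedra {U : Ultrafilter ι} {Ps : ι → Set (ℝ × ℝ)}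
    {P : Set (ℝ × ℝ)} (hPs : ∀ i, IsLatticePolyhedron (Ps i)) (hP : IsLatticePolyhedron P)
    (h : ∀ α, ∀ᶠ i in (U : Filter ι), (intVec α ∈ Ps i ↔ intVec α ∈ P))
    {p : ι → ℝ × ℝ} {x : ℝ × ℝ} (hp : ∀ᶠ i in (U : Filter ι), p i ∈ Ps i)
    (hx : Tendsto p U (𝓝 x)) : x ∈ P := by
  have hcomb : ∀ i, ∃ (w : Fin 3 → ℝ) (z : Fin 3 → ℤ × ℤ), p i ∈ Ps i →
      (∀ j, 0 ≤ w j) ∧ ∑ j, w j = 1 ∧ (∀ j, intVec (z j) ∈ Ps i) ∧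
        ∑ j, w j • intVec (z j) = p i := by
    intro i
    by_cases hi : p i ∈ Ps i
    · have hi' := hi
      rw [(hPs i).2.1, Set.inter_comm, ← Set.image_preimage_eq_range_inter] at hi'
      obtain ⟨w, z, hwz⟩ := exists_fin_three_combination hi'
      exact ⟨w, z, fun _ => hwz⟩
    · exact ⟨0, 0, fun hi' => absurd hi' hi⟩
  choose w z hwz using hcomb
  obtain ⟨C, hC0, hC⟩ := eventually_linear_bounds hPs hP h 2 (by norm_num)
  have hx1 : Tendsto (fun i => (p i).1) U (𝓝 x.1) := (continuous_fst.tendsto x).comp hx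
  have hx2 : Tendsto (fun i => (p i).2) U (𝓝 x.2) := (continuous_snd.tendsto x).comp hx
  have hterm : ∀ j, ∃ v, Tendsto (fun i => w i j • intVec (z i j)) U (𝓝 v) := by
    intro j
    refine exists_tendsto_of_bounds C (2 * |x.1| + 2 * |x.2| + 4 + 2 * C) ?_
    have hx1' := hx1.eventually_lt_const (u := |x.1| + 1) (by linarith [le_abs_self x.1])
    have hx2' := hx2.eventually_lt_const (u := |x.2| + 1) (by linarith [le_abs_self x.2])
    filter_upwards [hp, hC, hx1', hx2'] with i hi hCi h1 h2
    obtain ⟨w0, w1, zP, hsum⟩ := hwz i hi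
    have hb : ∀ j, -C ≤ 2 * (w i j • intVec (z i j)).1 + (w i j • intVec (z i j)).2 ∧
        -C ≤ (w i j • intVec (z i j)).1 + 2 * (w i j • intVec (z i j)).2 := by
      intro j
      have hwj : w i j ≤ 1 := by
        rw [← w1]
        exact Finset.single_le_sum (fun k _ => w0 k) (Finset.mem_univ j)
      obtain ⟨b1, b2⟩ := hCi _ (zP j)
      push_cast at b1 b2
      have c1 := mul_le_mul_of_nonneg_left b1 (w0 j)
      have c2 := mul_le_mul_of_nonneg_left b2 (w0 j)
      have c3 := mul_le_mul_of_nonneg_right hwj hC0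
      simp only [Prod.smul_fst, Prod.smul_snd, smul_eq_mul]
      constructor
      · linear_combination c1 + c3
      · linear_combination c2 + c3
    have s1 := congrArg Prod.fst hsum
    have s2 := congrArg Prod.snd hsum
    simp only [Fin.sum_univ_three, Prod.fst_add, Prod.snd_add] at s1 s2
    have t0 := hb 0
    have t1 := hb 1
    have t2 := hb 2
    have n1 := abs_nonneg x.1
    have n2 := abs_nonneg x.2
    refine ⟨hb j, ?_⟩
    fin_cases j <;> constructor <;> dsimp only [Fin.zero_eta, Fin.mk_one, Fin.reduceFinMk] <;>
      linarith
  have hweight : ∀ j, ∃ w₀, Tendsto (fun i => w i j) U (𝓝 w₀) := by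
    intro j
    obtain ⟨y, -, hy⟩ := (isCompact_Icc (a := (0 : ℝ)) (b := 1)).ultrafilter_le_nhds
      (U.map fun i => w i j) (by
        rw [le_principal_iff]
        change ∀ᶠ i in (U : Filter ι), w i j ∈ _
        filter_upwards [hp] with i hi
        obtain ⟨w0, w1, -, -⟩ := hwz i hi
        refine ⟨w0 j, ?_⟩
        rw [← w1]
        exact Finset.single_le_sum (fun k _ => w0 k) (Finset.mem_univ j))
    exact ⟨y, hy⟩
  choose v hv using hterm
  choose w₀ hw₀ using hweight
  have hlim : ∀ j, ∃ a ∈ P, ∃ d ∈ Quadrant, v j = w₀ j • a + d := fun j =>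
    exists_weighted_limit hPs hP h (hp.mono fun i hi => (hwz i hi).1 j)
      (hp.mono fun i hi => (hwz i hi).2.2.1 j) (hw₀ j) (hv j)
  choose a ha d hd hvad using hlim
  have hw₀0 : ∀ j, 0 ≤ w₀ j := fun j =>
    ge_of_tendsto (hw₀ j) (hp.mono fun i hi => (hwz i hi).1 j)
  have hw₀1 : ∑ j, w₀ j = 1 :=
    tendsto_nhds_unique (tendsto_finsetSum _ fun j _ => hw₀ j)
      (tendsto_const_nhds.congr' (hp.mono fun i hi => (hwz i hi).2.1.symm))
  have hsum : x = ∑ j, v j :=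
    tendsto_nhds_unique hx ((tendsto_finsetSum _ fun j _ => hv j).congr'
      (hp.mono fun i hi => (hwz i hi).2.2.2))
  have hmem : ∑ j, w₀ j • a j ∈ P :=
    hP.convex.sum_mem (fun j _ => hw₀0 j) hw₀1 fun j _ => ha j
  have hx' : x = ∑ j, w₀ j • a j + ∑ j, d j := by
    rw [hsum, ← Finset.sum_add_distrib]
    exact Finset.sum_congr rfl fun j _ => hvad j
  refine quadrant_translate_mem hP hmem ?_ ?_
  · rw [hx', Prod.fst_add, Prod.fst_sum (f := d)]
    exact le_add_of_nonneg_right (Finset.sum_nonneg fun j _ => (hd j).1)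
  · rw [hx', Prod.snd_add, Prod.snd_sum (f := d)]
    exact le_add_of_nonneg_right (Finset.sum_nonneg fun j _ => (hd j).2)

theorem eventually_mem_of_mem {F : Filter ι} {Ps : ι → Set (ℝ × ℝ)} {P : Set (ℝ × ℝ)}
    (hPs : ∀ i, IsLatticePolyhedron (Ps i)) (hP : IsLatticePolyhedron P)
    (h : ∀ α, ∀ᶠ i in F, (intVec α ∈ Ps i ↔ intVec α ∈ P)) {x : ℝ × ℝ} (hx : x ∈ P) :
    ∀ᶠ i in F, x ∈ Ps i := by
  have hsub : P ⊆ {x | ∀ᶠ i in F, x ∈ Ps i} := by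
    rw [hP.2.1]
    refine convexHull_min ?_ ?_
    · rintro _ ⟨ha, a, rfl⟩
      exact (h a).mono fun i hi => hi.2 ha
    · intro y hy z hz s t hs ht hst
      filter_upwards [hy, hz] with i h1 h2 using (hPs i).convex h1 h2 hs ht hst
  exact hsub hx

theorem mem_add_of_eventually {U : Ultrafilter ι} {Ps Qs : ι → Set (ℝ × ℝ)} {P Q : Set (ℝ × ℝ)}
    (hPs : ∀ i, IsLatticePolyhedron (Ps i)) (hQs : ∀ i, IsLatticePolyhedron (Qs i))
    (hP : IsLatticePolyhedron P) (hQ : IsLatticePolyhedron Q)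
    (h1 : ∀ α, ∀ᶠ i in (U : Filter ι), (intVec α ∈ Ps i ↔ intVec α ∈ P))
    (h2 : ∀ α, ∀ᶠ i in (U : Filter ι), (intVec α ∈ Qs i ↔ intVec α ∈ Q)) {x : ℝ × ℝ}
    (hx : ∀ᶠ i in (U : Filter ι), x ∈ Ps i + Qs i) : x ∈ P + Q := by
  have hdec : ∀ i, ∃ p, x ∈ Ps i + Qs i → p ∈ Ps i ∧ x - p ∈ Qs i := by
    intro i
    by_cases hi : x ∈ Ps i + Qs i
    · obtain ⟨p, hp, q, hq, rfl⟩ := hi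
      exact ⟨p, fun _ => ⟨hp, by simpa using hq⟩⟩
    · exact ⟨0, fun hi' => absurd hi' hi⟩
  choose p hp using hdec
  obtain ⟨C, hC0, hC⟩ := eventually_linear_bounds hPs hP h1 2 (by norm_num)
  obtain ⟨D, hD0, hD⟩ := eventually_linear_bounds hQs hQ h2 2 (by norm_num)
  obtain ⟨y, hy⟩ : ∃ y, Tendsto p U (𝓝 y) := by
    refine exists_tendsto_of_bounds C (2 * |x.1| + 2 * |x.2| + D) ?_
    filter_upwards [hx, hC, hD] with i hi hCi hDi
    obtain ⟨m1, m2⟩ := hp i hi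
    obtain ⟨b1, b2⟩ := hDi _ m2
    have a1 := hCi _ m1
    push_cast at a1 b1 b2
    simp only [Prod.fst_sub, Prod.snd_sub] at b1 b2
    have := le_abs_self x.1
    have := le_abs_self x.2
    have := abs_nonneg x.1
    have := abs_nonneg x.2
    exact ⟨a1, by linarith, by linarith⟩
  refine ⟨y, mem_of_tendsto_of_latticePolyhedra hPs hP h1 (hx.mono fun i hi => (hp i hi).1) hy,
    x - y, mem_of_tendsto_of_latticePolyhedra hQs hQ h2 (hx.mono fun i hi => (hp i hi).2)
      (tendsto_const_nhds.sub hy), by simp⟩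

theorem eventually_mem_add_iff {F : Filter ι} {Ps Qs : ι → Set (ℝ × ℝ)} {P Q : Set (ℝ × ℝ)}
    (hPs : ∀ i, IsLatticePolyhedron (Ps i)) (hQs : ∀ i, IsLatticePolyhedron (Qs i))
    (hP : IsLatticePolyhedron P) (hQ : IsLatticePolyhedron Q)
    (h1 : ∀ α, ∀ᶠ i in F, (intVec α ∈ Ps i ↔ intVec α ∈ P))
    (h2 : ∀ α, ∀ᶠ i in F, (intVec α ∈ Qs i ↔ intVec α ∈ Q)) (x : ℝ × ℝ) :
    ∀ᶠ i in F, (x ∈ Ps i + Qs i ↔ x ∈ P + Q) := by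
  by_cases hx : x ∈ P + Q
  · obtain ⟨p, hp, q, hq, rfl⟩ := hx
    filter_upwards [eventually_mem_of_mem hPs hP h1 hp, eventually_mem_of_mem hQs hQ h2 hq]
      with i hpi hqi
    exact iff_of_true (Set.add_mem_add hpi hqi) (Set.add_mem_add hp hq)
  · simp only [hx, iff_false]
    by_contra hfr
    have hfr' : ∃ᶠ i in F, x ∈ Ps i + Qs i := hfr
    rw [frequently_iff_neBot] at hfr'
    have hU := Ultrafilter.of_le (F ⊓ 𝓟 {i | x ∈ Ps i + Qs i})
    have hUF := hU.trans inf_le_left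
    exact hx (mem_add_of_eventually hPs hQs hP hQ (fun α => (h1 α).filter_mono hUF)
      (fun α => (h2 α).filter_mono hUF) (le_principal_iff.1 (hU.trans inf_le_right)))

theorem seqConverges_iff_eventually {Ps : ℕ → Set (ℝ × ℝ)} {P : Set (ℝ × ℝ)} :
    SeqConverges Ps P ↔ ∃ β : ℕ → ℤ × ℤ, ∀ α : ℤ × ℤ, ∀ᶠ i in atTop,
      (intVec α ∈ intVec (-β i) +ᵥ Ps i ↔ intVec α ∈ P) := by
  refine exists_congr fun β => forall_congr' fun α => ?_
  have hmem : ∀ i, intVec α ∈ intVec (-β i) +ᵥ Ps i ↔ intVec (β i + α) ∈ Ps i := by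
    intro i
    rw [Set.mem_vadd_set_iff_neg_vadd_mem, intVec_neg, neg_neg, vadd_eq_add, intVec_add]
  simp only [hmem]
  constructor
  · rintro ⟨N, hN⟩
    filter_upwards [eventually_gt_atTop N] with i hi using hN i hi
  · intro h
    obtain ⟨N, hN⟩ := eventually_atTop.1 h
    exact ⟨N, fun i hi => hN i hi.le⟩

end

/-- Minkowski addition is continuous: if `(P i) → P` and `(Q i) → Q` (all lattice
polyhedra with recession cone `ℝ₊²`), then `(P i + Q i) → P + Q`. -/
theorem stmt12 (Ps Qs : ℕ → Set (ℝ × ℝ)) (P Q : Set (ℝ × ℝ))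
    (hPs : ∀ i, IsLatticePolyhedron (Ps i)) (hQs : ∀ i, IsLatticePolyhedron (Qs i))
    (hP : IsLatticePolyhedron P) (hQ : IsLatticePolyhedron Q)
    (h1 : SeqConverges Ps P) (h2 : SeqConverges Qs Q) :
    SeqConverges (fun i => Ps i + Qs i) (P + Q) := by
  rw [seqConverges_iff_eventually] at h1 h2 ⊢
  obtain ⟨β, hβ⟩ := h1
  obtain ⟨γ, hγ⟩ := h2
  refine ⟨β + γ, fun α => ?_⟩
  have hsum : ∀ i, intVec (-(β + γ) i) +ᵥ (Ps i + Qs i) =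
      (intVec (-β i) +ᵥ Ps i) + (intVec (-γ i) +ᵥ Qs i) := by
    intro i
    simp only [← Set.singleton_vadd, vadd_eq_add, Pi.add_apply, neg_add, intVec_add,
      ← Set.singleton_add_singleton]
    exact add_add_add_comm _ _ _ _
  simp only [hsum]
  exact eventually_mem_add_iff (fun i => (hPs i).vadd _) (fun i => (hQs i).vadd _) hP hQ hβ hγ _
end
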